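/- Let γ > 0 satisfy β + 2γ < 1, and assume in addition that σ < (1−β)(1−2γ)/γ − 2bβ. Then there exists α_0 > 0 (depending only on β, b, σ, γ) such that for every α ∈ (0, α_0) there exists a_0 > 1 with the property: for all a ≥ a_0 and all q ∈ ℕ, τ_q ℓ_q^{−α−2γ} ≤ 1. -/

import Mathlib

open Filter Topology

/-- `λ_q := ⌈a^(b^q)⌉`, as a real number. -/
noncomputable def lam (a b : ℝ) (q : ℕ) : ℝ := (⌈a ^ (b ^ q)⌉₊ : ℝ)

/-- `δ_q := λ_q^(-2β)`. -/
noncomputable def del (a b β : ℝ) (q : ℕ) : ℝ := lam a b q ^ (-(2 * β))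

/-- `ε_q := λ_q^(-σ)`. -/
noncomputable def eps (a b σ : ℝ) (q : ℕ) : ℝ := lam a b q ^ (-σ)

/-- `τ_q := δ_q^(-1/2) λ_q^(-1-3α)`. -/
noncomputable def tau (a b β α : ℝ) (q : ℕ) : ℝ :=
  del a b β q ^ (-(1/2 : ℝ)) * lam a b q ^ (-(1 + 3 * α))

/-- `ℓ_q := δ_{q+1}^(1/2) δ_q^(-1/2) λ_q^(-(1+σ/2+3α/2))`. -/
noncomputable def ell (a b β σ α : ℝ) (q : ℕ) : ℝ :=
  del a b β (q + 1) ^ ((1/2 : ℝ)) * del a b β q ^ (-(1/2 : ℝ)) *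
    lam a b q ^ (-(1 + σ/2 + 3 * α / 2))

theorem rpow_le_lam (a b : ℝ) (q : ℕ) : a ^ (b ^ q) ≤ lam a b q :=
  Nat.le_ceil _

theorem lam_pos {a : ℝ} (ha : 0 < a) (b : ℝ) (q : ℕ) : 0 < lam a b q :=
  (Real.rpow_pos_of_pos ha _).trans_le (rpow_le_lam a b q)

theorem pow_mul_log_le_log_lam {a : ℝ} (ha : 0 < a) (b : ℝ) (q : ℕ) :
    b ^ q * Real.log a ≤ Real.log (lam a b q) := by
  rw [← Real.log_rpow ha]
  exact Real.log_le_log (Real.rpow_pos_of_pos ha _) (rpow_le_lam a b q)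

theorem log_lam_le {a b : ℝ} (ha : 1 ≤ a) (hb : 0 ≤ b) (q : ℕ) :
    Real.log (lam a b q) ≤ Real.log 2 + b ^ q * Real.log a := by
  have ha' : 0 < a := by linarith
  have h1 : 1 ≤ a ^ (b ^ q) := Real.one_le_rpow ha (by positivity)
  have h2 : lam a b q ≤ 2 * a ^ (b ^ q) := by
    have := (Nat.ceil_lt_add_one (zero_le_one.trans h1)).le
    unfold lam
    linarith
  rw [← Real.log_rpow ha', ← Real.log_mul two_ne_zero (by positivity)]
  exact Real.log_le_log (lam_pos ha' b q) h2

theorem log_lam_succ_le {a b : ℝ} (ha : 1 ≤ a) (hb : 0 ≤ b) (q : ℕ) :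
    Real.log (lam a b (q + 1)) ≤ Real.log 2 + b * Real.log (lam a b q) := by
  have h := mul_le_mul_of_nonneg_left (pow_mul_log_le_log_lam (by linarith : 0 < a) b q) hb
  have h' := log_lam_le ha hb (q + 1)
  rw [pow_succ'] at h'
  linarith

theorem tau_mul_ell_rpow_eq_exp {a : ℝ} (ha : 0 < a) (b β σ α s : ℝ) (q : ℕ) :
    tau a b β α q * ell a b β σ α q ^ s =
      Real.exp ((β - (1 + 3 * α)) * Real.log (lam a b q) +
        s * ((β - (1 + σ / 2 + 3 * α / 2)) * Real.log (lam a b q) -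
          β * Real.log (lam a b (q + 1)))) := by
  have hlam (n : ℕ) (x : ℝ) : lam a b n ^ x = Real.exp (Real.log (lam a b n) * x) :=
    Real.rpow_def_of_pos (lam_pos ha b n) x
  simp only [tau, ell, del, hlam, ← Real.exp_mul, ← Real.exp_add]
  congr 1
  ring

/-- if `β + 2γ < 1` and `σ < (1-β)(1-2γ)/γ - 2bβ`, then for sufficiently
small `α` and sufficiently large `a`, `τ_q ℓ_q^{-α-2γ} ≤ 1` for all `q`. -/
theorem stmt4 (β b σ γ : ℝ) (hβ : 0 < β) (hβ' : β < 1/3) (hb : 1 < b) (hσ : 0 < σ)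
    (hγ : 0 < γ) (hβγ : β + 2 * γ < 1)
    (hσ2 : σ < (1 - β) * (1 - 2 * γ) / γ - 2 * b * β) :
    ∃ α0 : ℝ, 0 < α0 ∧ ∀ α : ℝ, 0 < α → α < α0 →
      ∃ a0 : ℝ, 1 < a0 ∧ ∀ a : ℝ, a0 ≤ a → ∀ q : ℕ,
        tau a b β α q * ell a b β σ α q ^ (-α - 2 * γ) ≤ 1 := by
  let f : ℝ → ℝ := fun α =>
    β - (1 + 3 * α) + (α + 2 * γ) * (β * b - β + 1 + σ / 2 + 3 * α / 2)
  have hf0 : f 0 < 0 := by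
    have h := (lt_div_iff₀ hγ).1 (lt_sub_iff_add_lt.1 hσ2)
    simp only [f]
    linarith
  have hf : Continuous f := by fun_prop
  obtain ⟨α0, hα0, hsmall⟩ := Metric.eventually_nhds_iff.1
    (hf.continuousAt.eventually_lt_const hf0)
  refine ⟨α0, hα0, fun α hα hαα0 => ?_⟩
  have hfα : f α < 0 := hsmall (by rwa [Real.dist_eq, sub_zero, abs_of_pos hα])
  have hlog2 : 0 < Real.log 2 := Real.log_pos one_lt_two
  have hK : 0 < (α + 2 * γ) * β * Real.log 2 := by positivity
  have hK' := div_pos hK (neg_pos.2 hfα)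
  refine ⟨Real.exp ((α + 2 * γ) * β * Real.log 2 / -f α), Real.one_lt_exp_iff.2 hK',
    fun a ha q => ?_⟩
  have ha1 : 1 ≤ a := (Real.one_lt_exp_iff.2 hK').le.trans ha
  have ha0 : 0 < a := by linarith
  have hloga := (Real.le_log_iff_exp_le ha0).2 ha
  have hL : Real.log a ≤ Real.log (lam a b q) :=
    (le_mul_of_one_le_left (Real.log_nonneg ha1) (one_le_pow₀ hb.le)).trans
      (pow_mul_log_le_log_lam ha0 b q)
  have hmain := (div_le_iff₀ (neg_pos.2 hfα)).1 (hloga.trans hL)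
  have hsucc := mul_le_mul_of_nonneg_left (log_lam_succ_le ha1 (by linarith : 0 ≤ b) q)
    (by positivity : 0 ≤ (α + 2 * γ) * β)
  rw [tau_mul_ell_rpow_eq_exp ha0, Real.exp_le_one_iff]
  simp only [f] at hmain
  linarith
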